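/- arXiv:2005.03797 — 9 statements merged into one kernel-verified Lean document; each statement's English description precedes it below -/
import Mathlib

section
/- For every x in the simplex Δ = {x ∈ ℝⁿ : xᵢ ≥ 0, Σᵢ xᵢ = m} and every p ∈ ℝⁿ, the impartial pairwise comparison dynamics satisfy Nash stationarity: ν^IPC(x,p) = 0 if and only if ωᵀp ≤ xᵀp for all ω ∈ Δ. -/
open Matrix Finset

/-- Nash stationarity of the impartial pairwise comparison (IPC) dynamics
on the simplex Δ = {x : xᵢ ≥ 0, Σ xᵢ = m}. -/
theorem stmt_1 {n : ℕ} (hn : 0 < n) (m : ℝ) (hm : 0 < m)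
    (φ : Fin n → ℝ → ℝ)
    (hφlip : ∀ j, ∃ K : NNReal, LipschitzWith K (φ j))
    (hφnonneg : ∀ j s, 0 ≤ φ j s)
    (hφpos : ∀ j s, 0 < s → 0 < φ j s)
    (hφzero : ∀ j s, s ≤ 0 → φ j s = 0)
    (x : Fin n → ℝ) (hx : (∀ i, 0 ≤ x i) ∧ ∑ i, x i = m)
    (p : Fin n → ℝ) :
    (∀ i, ∑ j, (x j * φ i (p i - p j) - x i * φ j (p j - p i)) = 0) ↔
      ∀ ω : Fin n → ℝ, ((∀ i, 0 ≤ ω i) ∧ ∑ i, ω i = m) → ω ⬝ᵥ p ≤ x ⬝ᵥ p := by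
  obtain ⟨hx0, hxm⟩ := hx
  haveI : Nonempty (Fin n) := ⟨⟨0, hn⟩⟩
  obtain ⟨k, hk⟩ := Finite.exists_max p
  constructor
  · intro h ω hω
    have h1 : ∑ j, x j * φ k (p k - p j) = 0 := by
      rw [← h k]
      refine Finset.sum_congr rfl fun j _ => ?_
      rw [hφzero j (p j - p k) (by linarith [hk j])]
      ring
    have h2 := (Finset.sum_eq_zero_iff_of_nonneg
      (fun j _ => mul_nonneg (hx0 j) (hφnonneg k (p k - p j)))).1 h1
    have h3 : ∀ j, x j * p j = x j * p k := by
      intro j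
      rcases mul_eq_zero.1 (h2 j (Finset.mem_univ j)) with h0 | h0
      · rw [h0]; ring
      · rcases (hk j).lt_or_eq with hl | he
        · exact absurd h0 (hφpos k _ (sub_pos.2 hl)).ne'
        · rw [he]
    calc ω ⬝ᵥ p = ∑ j, ω j * p j := rfl
      _ ≤ ∑ j, ω j * p k :=
        Finset.sum_le_sum fun j _ => mul_le_mul_of_nonneg_left (hk j) (hω.1 j)
      _ = ∑ j, x j * p k := by rw [← Finset.sum_mul, ← Finset.sum_mul, hω.2, hxm]
      _ = ∑ j, x j * p j := Finset.sum_congr rfl fun j _ => (h3 j).symm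
      _ = x ⬝ᵥ p := rfl
  · intro h
    have h1 : m * p k ≤ ∑ j, x j * p j := by
      have := h (Pi.single k m) ⟨fun i => ?_, by simp⟩
      · rw [single_dotProduct] at this
        exact this
      · by_cases hi : i = k
        · subst hi; simp [hm.le]
        · simp [hi]
    have hnn : ∀ j ∈ (Finset.univ : Finset (Fin n)), 0 ≤ x j * (p k - p j) :=
      fun j _ => mul_nonneg (hx0 j) (sub_nonneg.2 (hk j))
    have h2 : ∑ j, x j * (p k - p j) = 0 := by
      apply le_antisymm _ (Finset.sum_nonneg hnn)
      simp only [mul_sub, Finset.sum_sub_distrib]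
      rw [← Finset.sum_mul, hxm]
      linarith
    have h3 := (Finset.sum_eq_zero_iff_of_nonneg hnn).1 h2
    have h4 : ∀ i j, x j * φ i (p i - p j) = 0 := by
      intro i j
      rcases mul_eq_zero.1 (h3 j (Finset.mem_univ j)) with h0 | h0
      · rw [h0, zero_mul]
      · rw [hφzero i _ (by linarith [hk i]), mul_zero]
    intro i
    refine Finset.sum_eq_zero fun j _ => ?_
    rw [h4 i j, h4 j i, sub_zero]
end

section
/- For every x in the simplex Δ and every p ∈ ℝⁿ: (i) σ^IPC(x,p) ≥ 0 and S^IPC(x,p) ≥ 0; (ii) σ^IPC(x,p) = 0 if and only if ν^IPC(x,p) = 0; and (iii) S^IPC(x,p) = 0 if and only if ν^IPC(x,p) = 0. -/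
open Matrix Finset

/-- The impartial pairwise comparison (IPC) evolutionary dynamics. -/
noncomputable def nuIPC {n : ℕ} (φ : Fin n → ℝ → ℝ) (x p : Fin n → ℝ) : Fin n → ℝ :=
  fun i => ∑ j, (x j * φ i (p i - p j) - x i * φ j (p j - p i))

/-- The IPC storage function S^IPC(x,p) = Σᵢ xᵢ Σⱼ ∫₀^{pⱼ−pᵢ} φⱼ(s) ds. -/
noncomputable def SIPC {n : ℕ} (φ : Fin n → ℝ → ℝ) (x p : Fin n → ℝ) : ℝ :=
  ∑ i, x i * ∑ j, ∫ s in (0:ℝ)..(p j - p i), φ j s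

/-- σ^IPC(x,p) = − Σᵢ ν^IPC_i(x,p) Σⱼ ∫₀^{pⱼ−pᵢ} φⱼ(s) ds. -/
noncomputable def sigmaIPC {n : ℕ} (φ : Fin n → ℝ → ℝ) (x p : Fin n → ℝ) : ℝ :=
  -∑ i, nuIPC φ x p i * ∑ j, ∫ s in (0:ℝ)..(p j - p i), φ j s

/-- nonnegativity of σ^IPC and S^IPC, and the zero-set equivalences with
ν^IPC = 0, on the simplex. -/
theorem stmt_2 {n : ℕ} (hn : 0 < n) (m : ℝ) (hm : 0 < m)
    (φ : Fin n → ℝ → ℝ)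
    (hφlip : ∀ j, ∃ K : NNReal, LipschitzWith K (φ j))
    (hφnonneg : ∀ j s, 0 ≤ φ j s)
    (hφpos : ∀ j s, 0 < s → 0 < φ j s)
    (hφzero : ∀ j s, s ≤ 0 → φ j s = 0)
    (x : Fin n → ℝ) (hx : (∀ i, 0 ≤ x i) ∧ ∑ i, x i = m)
    (p : Fin n → ℝ) :
    (0 ≤ sigmaIPC φ x p ∧ 0 ≤ SIPC φ x p) ∧
      (sigmaIPC φ x p = 0 ↔ nuIPC φ x p = 0) ∧
      (SIPC φ x p = 0 ↔ nuIPC φ x p = 0) := by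
  obtain ⟨hx0, -⟩ := hx
  have hint : ∀ j a b, IntervalIntegrable (φ j) MeasureTheory.volume a b := fun j a b => by
    obtain ⟨K, hK⟩ := hφlip j
    exact hK.continuous.intervalIntegrable a b
  set Φ : Fin n → ℝ → ℝ := fun j t => ∫ s in (0:ℝ)..t, φ j s with hΦ
  have hmono : ∀ j s t, s ≤ t → Φ j s ≤ Φ j t := by
    intro j s t hst
    have h1 := intervalIntegral.integral_add_adjacent_intervals (hint j 0 s) (hint j s t)
    have h2 : 0 ≤ ∫ u in s..t, φ j u :=
      intervalIntegral.integral_nonneg hst (fun u _ => hφnonneg j u)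
    simp only [hΦ]
    linarith
  have hpos : ∀ j t, 0 < t → 0 < Φ j t := by
    intro j t ht
    exact intervalIntegral.intervalIntegral_pos_of_pos_on (hint j 0 t)
      (fun u hu => hφpos j u hu.1) ht
  have hzero : ∀ j t, t ≤ 0 → Φ j t = 0 := by
    intro j t ht
    simp only [hΦ]
    rw [intervalIntegral.integral_congr (g := fun _ => (0:ℝ))]
    · simp
    · intro u hu
      rw [Set.uIcc_of_ge ht] at hu
      exact hφzero j u hu.2
  have hnn : ∀ j t, 0 ≤ Φ j t := by
    intro j t
    rcases le_or_gt t 0 with h | h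
    · exact (hzero j t h).ge
    · exact (hpos j t h).le
  set F : Fin n → ℝ := fun i => ∑ j, Φ j (p j - p i) with hF
  have hFlt : ∀ i j, p i < p j → F j < F i := by
    intro i j hij
    apply Finset.sum_lt_sum
    · intro k _
      exact hmono k _ _ (by linarith)
    · refine ⟨j, Finset.mem_univ _, ?_⟩
      rw [hzero j (p j - p j) (by simp)]
      exact hpos j _ (by linarith)
  set a : Fin n → Fin n → ℝ := fun i j => x i * φ j (p j - p i) with ha
  have hsig : sigmaIPC φ x p = ∑ i, ∑ j, a i j * (F i - F j) := by
    have h0 : sigmaIPC φ x p = -∑ i, (∑ j, (a j i - a i j)) * F i := rfl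
    have h1 : ∑ i, ∑ j, a i j * F j = ∑ i, ∑ j, a j i * F i := Finset.sum_comm
    rw [h0]
    simp only [Finset.sum_mul, mul_sub, sub_mul, Finset.sum_sub_distrib]
    rw [h1]
    ring
  have hS : SIPC φ x p = ∑ i, ∑ j, x i * Φ j (p j - p i) := by
    have h0 : SIPC φ x p = ∑ i, x i * ∑ j, Φ j (p j - p i) := rfl
    rw [h0]
    simp only [Finset.mul_sum]
  have ht : ∀ i j, 0 ≤ a i j * (F i - F j) := by
    intro i j
    rcases le_or_gt (p j) (p i) with h | h
    · simp [ha, hφzero j (p j - p i) (by linarith)]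
    · exact mul_nonneg (mul_nonneg (hx0 i) (hφnonneg _ _)) (by linarith [hFlt i j h])
  have hs : ∀ i j, 0 ≤ x i * Φ j (p j - p i) := fun i j => mul_nonneg (hx0 i) (hnn _ _)
  have hsig0 : sigmaIPC φ x p = 0 ↔ ∀ i j, p i < p j → x i = 0 := by
    rw [hsig, Finset.sum_eq_zero_iff_of_nonneg (fun i _ => Finset.sum_nonneg (fun j _ => ht i j))]
    simp only [Finset.sum_eq_zero_iff_of_nonneg (fun j _ => ht _ j), Finset.mem_univ, true_imp_iff]
    refine forall_congr' fun i => forall_congr' fun j => ?_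
    rcases le_or_gt (p j) (p i) with h | h
    · simp [ha, hφzero j (p j - p i) (by linarith), h.not_gt]
    · have h1 := (hφpos j (p j - p i) (by linarith)).ne'
      have h2 : F i - F j ≠ 0 := (sub_pos.2 (hFlt i j h)).ne'
      simp [ha, h, h1, h2]
  have hS0 : SIPC φ x p = 0 ↔ ∀ i j, p i < p j → x i = 0 := by
    rw [hS, Finset.sum_eq_zero_iff_of_nonneg (fun i _ => Finset.sum_nonneg (fun j _ => hs i j))]
    simp only [Finset.sum_eq_zero_iff_of_nonneg (fun j _ => hs _ j), Finset.mem_univ, true_imp_iff]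
    refine forall_congr' fun i => forall_congr' fun j => ?_
    rcases le_or_gt (p j) (p i) with h | h
    · simp [hzero j (p j - p i) (by linarith), h.not_gt]
    · have h1 := (hpos j (p j - p i) (by linarith)).ne'
      simp [h, h1]
  have hnu : nuIPC φ x p = 0 ↔ ∀ i j, p i < p j → x i = 0 := by
    constructor
    · intro h
      rw [← hsig0]
      simp [sigmaIPC, h]
    · intro h
      have ha0 : ∀ i j, a i j = 0 := by
        intro i j
        rcases le_or_gt (p j) (p i) with h' | h'
        · simp [ha, hφzero j (p j - p i) (by linarith)]
        · simp [ha, h i j h']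
      funext i
      have h0 : nuIPC φ x p i = ∑ j, (a j i - a i j) := rfl
      rw [h0]
      simp [ha0]
  refine ⟨⟨?_, ?_⟩, hsig0.trans hnu.symm, hS0.trans hnu.symm⟩
  · rw [hsig]
    exact Finset.sum_nonneg fun i _ => Finset.sum_nonneg fun j _ => ht i j
  · rw [hS]
    exact Finset.sum_nonneg fun i _ => Finset.sum_nonneg fun j _ => hs i j
end

section
/- The IPC storage function satisfies the δ-passivity dissipation inequality: for every x in the simplex Δ and all p, u ∈ ℝⁿ, the directional derivative of S^IPC in x along ν^IPC(x,p) plus the directional derivative of S^IPC in p along u is at most −σ^IPC(x,p) + uᵀν^IPC(x,p); that is, (∂S^IPC/∂x)(x,p)·ν^IPC(x,p) + (∂S^IPC/∂p)(x,p)·u ≤ −σ^IPC(x,p) + uᵀν^IPC(x,p). -/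
open Matrix Finset

/-- the δ-passivity dissipation inequality for the IPC storage function:
(∂S/∂x)·ν + (∂S/∂p)·u ≤ −σ + uᵀν on the simplex, for all p, u. -/
theorem stmt_3 {n : ℕ} (hn : 0 < n) (m : ℝ) (hm : 0 < m)
    (φ : Fin n → ℝ → ℝ)
    (hφlip : ∀ j, ∃ K : NNReal, LipschitzWith K (φ j))
    (hφnonneg : ∀ j s, 0 ≤ φ j s)
    (hφpos : ∀ j s, 0 < s → 0 < φ j s)
    (hφzero : ∀ j s, s ≤ 0 → φ j s = 0)
    (x : Fin n → ℝ) (hx : (∀ i, 0 ≤ x i) ∧ ∑ i, x i = m)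
    (p u : Fin n → ℝ) :
    fderiv ℝ (fun w : (Fin n → ℝ) × (Fin n → ℝ) => SIPC φ w.1 w.2) (x, p)
        (nuIPC φ x p, u) ≤ -sigmaIPC φ x p + u ⬝ᵥ nuIPC φ x p := by
  have hc : ∀ j, Continuous (φ j) := fun j => (hφlip j).choose_spec.continuous
  have hG : ∀ i j : Fin n, HasFDerivAt
      (fun w : (Fin n → ℝ) × (Fin n → ℝ) => ∫ s in (0:ℝ)..(w.2 j - w.2 i), φ j s)
      (φ j (p j - p i) •
        (((ContinuousLinearMap.proj j : (Fin n → ℝ) →L[ℝ] ℝ) -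
          (ContinuousLinearMap.proj i : (Fin n → ℝ) →L[ℝ] ℝ)).comp
          (ContinuousLinearMap.snd ℝ (Fin n → ℝ) (Fin n → ℝ)))) (x, p) := by
    intro i j
    have h1 : HasDerivAt (fun t : ℝ => ∫ s in (0:ℝ)..t, φ j s) (φ j (p j - p i)) (p j - p i) :=
      intervalIntegral.integral_hasDerivAt_right ((hc j).intervalIntegrable _ _)
        ((hc j).stronglyMeasurableAtFilter _ _) (hc j).continuousAt
    have h2 : HasFDerivAt (fun w : (Fin n → ℝ) × (Fin n → ℝ) => w.2 j - w.2 i)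
        (((ContinuousLinearMap.proj j : (Fin n → ℝ) →L[ℝ] ℝ) -
          (ContinuousLinearMap.proj i : (Fin n → ℝ) →L[ℝ] ℝ)).comp
          (ContinuousLinearMap.snd ℝ (Fin n → ℝ) (Fin n → ℝ))) (x, p) :=
      (((ContinuousLinearMap.proj j : (Fin n → ℝ) →L[ℝ] ℝ) -
          (ContinuousLinearMap.proj i : (Fin n → ℝ) →L[ℝ] ℝ)).comp
          (ContinuousLinearMap.snd ℝ (Fin n → ℝ) (Fin n → ℝ))).hasFDerivAt
    exact HasDerivAt.comp_hasFDerivAt (x, p) h1 h2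
  have hX : ∀ i : Fin n, HasFDerivAt (fun w : (Fin n → ℝ) × (Fin n → ℝ) => w.1 i)
      ((ContinuousLinearMap.proj i : (Fin n → ℝ) →L[ℝ] ℝ).comp
        (ContinuousLinearMap.fst ℝ (Fin n → ℝ) (Fin n → ℝ))) (x, p) :=
    fun i => ((ContinuousLinearMap.proj i : (Fin n → ℝ) →L[ℝ] ℝ).comp
        (ContinuousLinearMap.fst ℝ (Fin n → ℝ) (Fin n → ℝ))).hasFDerivAt
  have hS := HasFDerivAt.fun_sum (u := Finset.univ) (fun i _ =>
    (hX i).mul (HasFDerivAt.fun_sum (u := Finset.univ) (fun j _ => hG i j)))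
  have hS' : HasFDerivAt (fun w : (Fin n → ℝ) × (Fin n → ℝ) => SIPC φ w.1 w.2) _ (x, p) := hS
  rw [hS'.fderiv]
  have key : u ⬝ᵥ nuIPC φ x p = ∑ i, x i * ∑ j, φ j (p j - p i) * (u j - u i) := by
    simp only [dotProduct, nuIPC, Finset.mul_sum, mul_sub, Finset.sum_sub_distrib]
    congr 1
    · rw [Finset.sum_comm]
      refine Finset.sum_congr rfl fun i _ => Finset.sum_congr rfl fun j _ => by ring
    · refine Finset.sum_congr rfl fun i _ => Finset.sum_congr rfl fun j _ => by ring
  rw [key, sigmaIPC, neg_neg]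
  apply le_of_eq
  simp [ContinuousLinearMap.sum_apply, Finset.sum_add_distrib]
  rw [add_comm]
  congr 1
  refine Finset.sum_congr rfl fun i _ => by ring
end

section
/- Let Π = Πᵀ ∈ ℝ^{2n×2n} have n×n blocks Π₁₁ = 0, Π₁₂ = Π₂₁ᵀ, Π₂₂, and let F : ℝⁿ → ℝⁿ be continuously differentiable with Jacobian J(x). Then the pointwise condition ζᵀ(J(x)ᵀΠ₁₂ + Π₁₂ᵀJ(x) + Π₂₂)ζ ≤ 0 for all x ∈ X and all ζ ∈ TX is equivalent to the incremental quadratic constraint [F(x)−F(y); x−y]ᵀ Π [F(x)−F(y); x−y] ≤ 0 for all x, y ∈ X, i.e., 2(F(x)−F(y))ᵀΠ₁₂(x−y) + (x−y)ᵀΠ₂₂(x−y) ≤ 0 for all x, y ∈ X. -/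
open Matrix Finset

/-- The set X = X¹×⋯×X^ρ of social states (product of simplices). -/
def popX {ρ : ℕ} (nn : Fin ρ → ℕ) (m : Fin ρ → ℝ) :
    Set (((r : Fin ρ) × Fin (nn r)) → ℝ) :=
  {x | (∀ a, 0 ≤ x a) ∧ ∀ r : Fin ρ, ∑ i : Fin (nn r), x ⟨r, i⟩ = m r}

/-- The tangent space TX = TX¹×⋯×TX^ρ. -/
def popTX {ρ : ℕ} (nn : Fin ρ → ℕ) :
    Set (((r : Fin ρ) × Fin (nn r)) → ℝ) :=
  {ζ | ∀ r : Fin ρ, ∑ i : Fin (nn r), ζ ⟨r, i⟩ = 0}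

/-- derivative of the incremental form along a line -/
lemma line_deriv {ι : Type*} [Fintype ι] (P12 P22 : Matrix ι ι ℝ)
    (F : (ι → ℝ) → ι → ℝ) (hF : ContDiff ℝ 1 F) (y ζ : ι → ℝ) (t : ℝ) :
    HasDerivAt (fun t : ℝ => 2 * (F (y + t • ζ) ⬝ᵥ (P12 *ᵥ ζ)) + t * (ζ ⬝ᵥ (P22 *ᵥ ζ)))
      (fderiv ℝ F (y + t • ζ) ζ ⬝ᵥ (P12 *ᵥ ζ) + (P12 *ᵥ ζ) ⬝ᵥ fderiv ℝ F (y + t • ζ) ζ +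
          ζ ⬝ᵥ (P22 *ᵥ ζ)) t := by
  have h1 : HasDerivAt (fun t : ℝ => y + t • ζ) ζ t := by
    simpa using ((hasDerivAt_id t).smul_const ζ).const_add y
  have h2 : HasDerivAt (fun t : ℝ => F (y + t • ζ)) (fderiv ℝ F (y + t • ζ) ζ) t :=
    ((hF.differentiable (by norm_num)) (y + t • ζ)).hasFDerivAt.comp_hasDerivAt t h1
  have h3 : HasDerivAt (fun t : ℝ => F (y + t • ζ) ⬝ᵥ (P12 *ᵥ ζ))
      (fderiv ℝ F (y + t • ζ) ζ ⬝ᵥ (P12 *ᵥ ζ)) t := by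
    unfold dotProduct
    rw [hasDerivAt_pi] at h2
    exact HasDerivAt.fun_sum fun i _ => (h2 i).mul_const _
  have h4 := (h3.const_mul 2).add ((hasDerivAt_id t).mul_const (ζ ⬝ᵥ (P22 *ᵥ ζ)))
  refine HasDerivAt.congr_deriv h4 ?_
  rw [dotProduct_comm (P12 *ᵥ ζ)]
  ring

lemma popX_sub {ρ : ℕ} {nn : Fin ρ → ℕ} {m : Fin ρ → ℝ} {x y}
    (hx : x ∈ popX nn m) (hy : y ∈ popX nn m) : x - y ∈ popTX nn := by
  intro r
  simp [hx.2 r, hy.2 r]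

lemma popX_line {ρ : ℕ} {nn : Fin ρ → ℕ} {m : Fin ρ → ℝ} {x y}
    (hx : x ∈ popX nn m) (hy : y ∈ popX nn m) {t : ℝ} (h0 : 0 ≤ t) (h1 : t ≤ 1) :
    y + t • (x - y) ∈ popX nn m := by
  refine ⟨fun a => ?_, fun r => ?_⟩
  · have := hx.1 a
    have := hy.1 a
    simp only [Pi.add_apply, Pi.smul_apply, Pi.sub_apply, smul_eq_mul]
    nlinarith [mul_nonneg h0 (hx.1 a), mul_nonneg (sub_nonneg.2 h1) (hy.1 a)]
  · simp [Finset.sum_add_distrib, ← Finset.mul_sum, hx.2 r, hy.2 r]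

lemma interior_case {ρ : ℕ} (nn : Fin ρ → ℕ) (m : Fin ρ → ℝ)
    (P12 P22 : Matrix ((r : Fin ρ) × Fin (nn r)) ((r : Fin ρ) × Fin (nn r)) ℝ)
    (F : (((r : Fin ρ) × Fin (nn r)) → ℝ) → ((r : Fin ρ) × Fin (nn r)) → ℝ)
    (hF : ContDiff ℝ 1 F)
    (H : ∀ x ∈ popX nn m, ∀ y ∈ popX nn m,
        2 * ((F x - F y) ⬝ᵥ (P12 *ᵥ (x - y))) + (x - y) ⬝ᵥ (P22 *ᵥ (x - y)) ≤ 0)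
    (x) (hx : x ∈ popX nn m) (hpos : ∀ a, 0 < x a) (ζ) (hζ : ζ ∈ popTX nn) :
    fderiv ℝ F x ζ ⬝ᵥ (P12 *ᵥ ζ) + (P12 *ᵥ ζ) ⬝ᵥ fderiv ℝ F x ζ + ζ ⬝ᵥ (P22 *ᵥ ζ) ≤ 0 := by
  have hd := line_deriv P12 P22 F hF x ζ 0
  have hx0 : x + (0 : ℝ) • ζ = x := by simp
  rw [hx0] at hd
  have hs := hd.tendsto_slope_zero_right
  refine le_of_tendsto hs ?_
  have hev : ∀ᶠ t : ℝ in nhdsWithin 0 (Set.Ioi 0), ∀ a, 0 < (x + t • ζ) a := by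
    apply Filter.Eventually.filter_mono nhdsWithin_le_nhds
    rw [Filter.eventually_all]
    intro a
    have hc : Continuous (fun t : ℝ => (x + t • ζ) a) := by
      simp only [Pi.add_apply, Pi.smul_apply, smul_eq_mul]
      fun_prop
    exact hc.continuousAt.eventually_const_lt (by simpa using hpos a)
  filter_upwards [hev, self_mem_nhdsWithin] with t ht ht0
  have ht0 : 0 < t := ht0
  have hmem : x + t • ζ ∈ popX nn m := by
    refine ⟨fun a => (ht a).le, fun r => ?_⟩
    have := hζ r
    simp [Finset.sum_add_distrib, ← Finset.mul_sum, hx.2 r, this]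
  have := H _ hmem x hx
  simp only [add_sub_cancel_left, mulVec_smul, dotProduct_smul, smul_dotProduct, sub_dotProduct,
    smul_eq_mul] at this
  simp only [zero_add, hx0, zero_mul, add_zero, smul_eq_mul]
  have h2 : t * (2 * (F (x + t • ζ) ⬝ᵥ (P12 *ᵥ ζ)) + t * (ζ ⬝ᵥ (P22 *ᵥ ζ))
      - 2 * (F x ⬝ᵥ (P12 *ᵥ ζ))) ≤ 0 := by linarith
  exact mul_nonpos_of_nonneg_of_nonpos (inv_nonneg.2 ht0.le) (by
    by_contra hcon
    push Not at hcon
    linarith [mul_pos ht0 hcon])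

/-- with Π₁₁ = 0, the pointwise Jacobian condition
ζᵀ(J(x)ᵀΠ₁₂ + Π₁₂ᵀJ(x) + Π₂₂)ζ ≤ 0 on X × TX is equivalent to the incremental quadratic
constraint 2(F(x)−F(y))ᵀΠ₁₂(x−y) + (x−y)ᵀΠ₂₂(x−y) ≤ 0 on X × X. -/
theorem stmt_5 {ρ : ℕ} (hρ : 0 < ρ) (nn : Fin ρ → ℕ) (hnn : ∀ r, 0 < nn r)
    (m : Fin ρ → ℝ) (hm : ∀ r, 0 < m r)
    (P12 P22 : Matrix ((r : Fin ρ) × Fin (nn r)) ((r : Fin ρ) × Fin (nn r)) ℝ)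
    (hP22 : P22.IsSymm)
    (F : (((r : Fin ρ) × Fin (nn r)) → ℝ) → ((r : Fin ρ) × Fin (nn r)) → ℝ)
    (hF : ContDiff ℝ 1 F) :
    (∀ x ∈ popX nn m, ∀ ζ ∈ popTX nn,
        fderiv ℝ F x ζ ⬝ᵥ (P12 *ᵥ ζ) + (P12 *ᵥ ζ) ⬝ᵥ fderiv ℝ F x ζ +
          ζ ⬝ᵥ (P22 *ᵥ ζ) ≤ 0) ↔
      (∀ x ∈ popX nn m, ∀ y ∈ popX nn m,
        2 * ((F x - F y) ⬝ᵥ (P12 *ᵥ (x - y))) + (x - y) ⬝ᵥ (P22 *ᵥ (x - y)) ≤ 0) := by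
  constructor
  · intro H x hx y hy
    have hd := line_deriv P12 P22 F hF y (x - y)
    obtain ⟨c, hc, he⟩ := exists_hasDerivAt_eq_slope _ _ (zero_lt_one (α := ℝ))
      (fun t _ => (hd t).continuousAt.continuousWithinAt) (fun t _ => hd t)
    have h := H _ (popX_line hx hy hc.1.le hc.2.le) _ (popX_sub hx hy)
    rw [he] at h
    simp only [one_smul, add_sub_cancel, zero_smul, add_zero, one_mul, zero_mul, sub_zero,
      div_one] at h
    rw [sub_dotProduct]
    linarith
  · intro H x hx ζ hζ
    let c : ((r : Fin ρ) × Fin (nn r)) → ℝ := fun a => m a.1 / nn a.1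
    have hn : ∀ r, (0 : ℝ) < nn r := fun r => by exact_mod_cast hnn r
    have hcpos : ∀ a, 0 < c a := fun a => div_pos (hm _) (hn _)
    have hc : c ∈ popX nn m := by
      refine ⟨fun a => (hcpos a).le, fun r => ?_⟩
      have := (hn r).ne'
      simp [c]
      field_simp
    let G : (((r : Fin ρ) × Fin (nn r)) → ℝ) → ℝ := fun z =>
      fderiv ℝ F z ζ ⬝ᵥ (P12 *ᵥ ζ) + (P12 *ᵥ ζ) ⬝ᵥ fderiv ℝ F z ζ + ζ ⬝ᵥ (P22 *ᵥ ζ)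
    have hGc : Continuous G := by
      have h1 : Continuous (fun z => fderiv ℝ F z ζ) :=
        (hF.continuous_fderiv (by norm_num)).clm_apply continuous_const
      exact ((h1.dotProduct continuous_const).add
        (continuous_const.dotProduct h1)).add continuous_const
    have hl : Continuous (fun s : ℝ => G (x + s • (c - x))) := by fun_prop
    have ht : Filter.Tendsto (fun s : ℝ => G (x + s • (c - x))) (nhdsWithin 0 (Set.Ioi 0))
        (nhds (G x)) := by
      have := hl.tendsto 0
      simp only [zero_smul, add_zero] at this
      exact this.mono_left nhdsWithin_le_nhds
    refine le_of_tendsto ht ?_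
    filter_upwards [Ioo_mem_nhdsGT (zero_lt_one (α := ℝ))] with s hs
    refine interior_case nn m P12 P22 F hF H _ (popX_line hc hx hs.1.le hs.2.le) (fun a => ?_) ζ hζ
    simp only [Pi.add_apply, Pi.smul_apply, Pi.sub_apply, smul_eq_mul]
    nlinarith [mul_pos hs.1 (hcpos a), mul_nonneg (sub_nonneg.2 hs.2.le) (hx.1 a)]
end

section
/- (Corollary 1, weighted contraction, Lyapunov form.) Suppose for each population r the EDM νʳ admits a continuously differentiable storage Sʳ ≥ 0 and rate σʳ ≥ 0 satisfying, for all xʳ ∈ Xʳ, pʳ, uʳ ∈ ℝ^{nʳ}: (∂Sʳ/∂xʳ)·νʳ + (∂Sʳ/∂pʳ)·uʳ ≤ −σʳ(xʳ,pʳ) + (uʳ)ᵀνʳ(xʳ,pʳ), with Sʳ = 0 ⟺ νʳ = 0 ⟺ σʳ = 0. Suppose there are positive weights w¹,…,w^ρ such that, with W = diag(w¹I_{n¹},…,w^ρI_{n^ρ}), the weighted contraction condition ζᵀ(W J(x) + J(x)ᵀ W)ζ ≤ 0 holds for all ζ ∈ TX and x ∈ X, where J(x) = ∂F/∂x(x).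 Then for every x ∈ X, the composite function V(x) = Σᵣ wʳ Sʳ(xʳ, Fʳ(x)) satisfies: its derivative along the vector field x ↦ ν(x,F(x)), namely Σᵣ wʳ[(∂Sʳ/∂xʳ)(xʳ,Fʳ(x))·νʳ(xʳ,Fʳ(x)) + (∂Sʳ/∂pʳ)(xʳ,Fʳ(x))·(J(x)ν(x,F(x)))ʳ], is at most −Σᵣ wʳσʳ(xʳ,Fʳ(x)) ≤ 0. -/
open Matrix Finset

/-- The r-th block of a social-state vector. -/
def blk {ρ : ℕ} {nn : Fin ρ → ℕ} (x : ((r : Fin ρ) × Fin (nn r)) → ℝ) (r : Fin ρ) :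
    Fin (nn r) → ℝ :=
  fun i => x ⟨r, i⟩

/-- Concatenation of per-population vectors into a single vector. -/
def stack {ρ : ℕ} {nn : Fin ρ → ℕ} (v : (r : Fin ρ) → Fin (nn r) → ℝ) :
    ((r : Fin ρ) × Fin (nn r)) → ℝ :=
  fun a => v a.1 a.2

/-- Corollary 1, weighted contraction, Lyapunov form: with δ-passive
per-population storages and a weighted contraction condition for W = diag(wʳ I_{nʳ}),
the derivative of V(x) = Σ wʳSʳ(xʳ,Fʳ(x)) along x ↦ ν(x,F(x)) is at most
−Σ wʳσʳ(xʳ,Fʳ(x)) ≤ 0. -/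
theorem stmt_7 {ρ : ℕ} (hρ : 0 < ρ) (nn : Fin ρ → ℕ) (hnn : ∀ r, 0 < nn r)
    (m : Fin ρ → ℝ) (hm : ∀ r, 0 < m r)
    (F : (((r : Fin ρ) × Fin (nn r)) → ℝ) → ((r : Fin ρ) × Fin (nn r)) → ℝ)
    (hF : ContDiff ℝ 1 F)
    (νr : (r : Fin ρ) → (Fin (nn r) → ℝ) → (Fin (nn r) → ℝ) → (Fin (nn r) → ℝ))
    (hνlip : ∀ r, ∃ K : NNReal, LipschitzWith K
      (fun v : (Fin (nn r) → ℝ) × (Fin (nn r) → ℝ) => νr r v.1 v.2))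
    (hνtan : ∀ r xr pr, ∑ i, νr r xr pr i = 0)
    (Sr : (r : Fin ρ) → (Fin (nn r) → ℝ) × (Fin (nn r) → ℝ) → ℝ)
    (hSr : ∀ r, ContDiff ℝ 1 (Sr r))
    (σr : (r : Fin ρ) → (Fin (nn r) → ℝ) → (Fin (nn r) → ℝ) → ℝ)
    (hSrnonneg : ∀ r, ∀ xr, ((∀ i, 0 ≤ xr i) ∧ ∑ i, xr i = m r) → ∀ pr, 0 ≤ Sr r (xr, pr))
    (hσrnonneg : ∀ r, ∀ xr, ((∀ i, 0 ≤ xr i) ∧ ∑ i, xr i = m r) → ∀ pr, 0 ≤ σr r xr pr)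
    (hdissr : ∀ r, ∀ xr, ((∀ i, 0 ≤ xr i) ∧ ∑ i, xr i = m r) → ∀ pr ur,
      fderiv ℝ (Sr r) (xr, pr) (νr r xr pr, ur) ≤ -σr r xr pr + ur ⬝ᵥ νr r xr pr)
    (hSrzero : ∀ r, ∀ xr, ((∀ i, 0 ≤ xr i) ∧ ∑ i, xr i = m r) → ∀ pr,
      (Sr r (xr, pr) = 0 ↔ νr r xr pr = 0))
    (hσrzero : ∀ r, ∀ xr, ((∀ i, 0 ≤ xr i) ∧ ∑ i, xr i = m r) → ∀ pr,
      (σr r xr pr = 0 ↔ νr r xr pr = 0))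
    (w : Fin ρ → ℝ) (hw : ∀ r, 0 < w r)
    (hcontr : ∀ x ∈ popX nn m, ∀ ζ ∈ popTX nn,
      ζ ⬝ᵥ ((Matrix.diagonal fun a : (r : Fin ρ) × Fin (nn r) => w a.1) *ᵥ
          fderiv ℝ F x ζ) +
        fderiv ℝ F x ζ ⬝ᵥ
          ((Matrix.diagonal fun a : (r : Fin ρ) × Fin (nn r) => w a.1) *ᵥ ζ) ≤ 0) :
    ∀ x ∈ popX nn m,
      (∑ r, w r *
          fderiv ℝ (Sr r) (blk x r, blk (F x) r)
            (νr r (blk x r) (blk (F x) r),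
              blk (fderiv ℝ F x (stack fun r' => νr r' (blk x r') (blk (F x) r'))) r) ≤
        -(∑ r, w r * σr r (blk x r) (blk (F x) r))) ∧
      -(∑ r, w r * σr r (blk x r) (blk (F x) r)) ≤ 0 := by
  intro x hx
  have hxr : ∀ r, (∀ i, 0 ≤ blk x r i) ∧ ∑ i, blk x r i = m r :=
    fun r => ⟨fun i => hx.1 _, hx.2 r⟩
  refine ⟨?_, ?_⟩
  · have hc := hcontr x hx (stack fun r' => νr r' (blk x r') (blk (F x) r'))
      (fun r => hνtan r (blk x r) (blk (F x) r))
    generalize hu : fderiv ℝ F x (stack fun r' => νr r' (blk x r') (blk (F x) r')) = u at hc ⊢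
    have h1 : ∑ r, w r * (blk u r ⬝ᵥ νr r (blk x r) (blk (F x) r)) ≤ 0 := by
      have e1 : (stack fun r' => νr r' (blk x r') (blk (F x) r')) ⬝ᵥ
          ((Matrix.diagonal fun a : (r : Fin ρ) × Fin (nn r) => w a.1) *ᵥ u) =
          ∑ r, w r * (blk u r ⬝ᵥ νr r (blk x r) (blk (F x) r)) := by
        simp only [dotProduct, Matrix.mulVec_diagonal, Fintype.sum_sigma, Finset.mul_sum]
        refine Finset.sum_congr rfl fun r _ => Finset.sum_congr rfl fun i _ => ?_
        simp only [stack, blk]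
        ring
      have e2 : u ⬝ᵥ ((Matrix.diagonal fun a : (r : Fin ρ) × Fin (nn r) => w a.1) *ᵥ
          (stack fun r' => νr r' (blk x r') (blk (F x) r'))) =
          ∑ r, w r * (blk u r ⬝ᵥ νr r (blk x r) (blk (F x) r)) := by
        simp only [dotProduct, Matrix.mulVec_diagonal, Fintype.sum_sigma, Finset.mul_sum]
        refine Finset.sum_congr rfl fun r _ => Finset.sum_congr rfl fun i _ => ?_
        simp only [stack, blk]
        ring
      rw [e1, e2] at hc
      linarith
    have h2 := Finset.sum_le_sum fun r (_ : r ∈ Finset.univ) =>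
      mul_le_mul_of_nonneg_left (hdissr r (blk x r) (hxr r) (blk (F x) r) (blk u r)) (hw r).le
    refine h2.trans ?_
    simp only [mul_add, mul_neg, Finset.sum_add_distrib, Finset.sum_neg_distrib]
    linarith
  · exact neg_nonpos.mpr (Finset.sum_nonneg fun r _ =>
      mul_nonneg (hw r).le (hσrnonneg r _ (hxr r) _))
end

section
/- In the mixed-autonomy congestion game, with W = diag(μI_N, I_N): (i) for every x ∈ ℝ^{2N}_{≥0}, the matrix W·(∂F/∂x)(x) is symmetric and negative semidefinite; and (ii) consequently F is weighted contractive with weight matrix W, i.e., (W F(x) − W F(y))ᵀ(x − y) ≤ 0 for all x, y ∈ ℝ^{2N}_{≥0}. -/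
open Matrix Finset

/-- Link flows z(x) = μRᵀx^aut + Rᵀx^reg. -/
noncomputable def zflow {N L : ℕ} (μ : ℝ) (R : Matrix (Fin N) (Fin L) ℝ)
    (x : Fin N ⊕ Fin N → ℝ) : Fin L → ℝ :=
  fun ℓ => ∑ i, R i ℓ * (μ * x (Sum.inl i) + x (Sum.inr i))

/-- The mixed-autonomy congestion game payoff: Fᵢ(x) = F_{i+N}(x) = −Σℓ R_{iℓ}Φℓ(zℓ(x)). -/
noncomputable def Fpay {N L : ℕ} (μ : ℝ) (R : Matrix (Fin N) (Fin L) ℝ)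
    (Φ : Fin L → ℝ → ℝ) (x : Fin N ⊕ Fin N → ℝ) : Fin N ⊕ Fin N → ℝ :=
  Sum.elim (fun i => -∑ ℓ, R i ℓ * Φ ℓ (zflow μ R x ℓ))
    (fun i => -∑ ℓ, R i ℓ * Φ ℓ (zflow μ R x ℓ))

/-- The weighting matrix W = diag(μ I_N, I_N). -/
noncomputable def Wmu (N : ℕ) (μ : ℝ) : Matrix (Fin N ⊕ Fin N) (Fin N ⊕ Fin N) ℝ :=
  Matrix.diagonal (Sum.elim (fun _ : Fin N => μ) (fun _ : Fin N => 1))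

/-- The Jacobian matrix ∂F/∂x(x) of the payoff, taken within the orthant ℝ^{2N}_{≥0}. -/
noncomputable def Jpay {N L : ℕ} (μ : ℝ) (R : Matrix (Fin N) (Fin L) ℝ)
    (Φ : Fin L → ℝ → ℝ) (x : Fin N ⊕ Fin N → ℝ) :
    Matrix (Fin N ⊕ Fin N) (Fin N ⊕ Fin N) ℝ :=
  Matrix.of fun a b =>
    fderivWithin ℝ (Fpay μ R Φ) {y : Fin N ⊕ Fin N → ℝ | ∀ c, 0 ≤ y c} x (Pi.single b 1) a

/-- Weights. -/
noncomputable def wt10 {N : ℕ} (μ : ℝ) : Fin N ⊕ Fin N → ℝ :=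
  Sum.elim (fun _ => μ) (fun _ => 1)

/-- Routing matrix on the doubled index set. -/
def rho10 {N L : ℕ} (R : Matrix (Fin N) (Fin L) ℝ) (a : Fin N ⊕ Fin N) (ℓ : Fin L) : ℝ :=
  R (Sum.elim id id a) ℓ

/-- Link flow as a continuous linear map. -/
noncomputable def zc10 {N L : ℕ} (μ : ℝ) (R : Matrix (Fin N) (Fin L) ℝ) (ℓ : Fin L) :
    (Fin N ⊕ Fin N → ℝ) →L[ℝ] ℝ :=
  ∑ a, (wt10 μ a * rho10 R a ℓ) • ContinuousLinearMap.proj a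

lemma zc10_apply {N L : ℕ} (μ : ℝ) (R : Matrix (Fin N) (Fin L) ℝ) (ℓ : Fin L)
    (x : Fin N ⊕ Fin N → ℝ) : zc10 μ R ℓ x = ∑ a, wt10 μ a * rho10 R a ℓ * x a := by
  simp [zc10]

lemma zflow_eq10 {N L : ℕ} (μ : ℝ) (R : Matrix (Fin N) (Fin L) ℝ) (ℓ : Fin L)
    (x : Fin N ⊕ Fin N → ℝ) : zflow μ R x ℓ = zc10 μ R ℓ x := by
  rw [zc10_apply, Fintype.sum_sum_type, ← Finset.sum_add_distrib]
  unfold zflow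
  refine Finset.sum_congr rfl fun i _ => ?_
  simp [wt10, rho10]
  ring

lemma Fpay_eq10 {N L : ℕ} (μ : ℝ) (R : Matrix (Fin N) (Fin L) ℝ) (Φ : Fin L → ℝ → ℝ)
    (x : Fin N ⊕ Fin N → ℝ) (a : Fin N ⊕ Fin N) :
    Fpay μ R Φ x a = -∑ ℓ, rho10 R a ℓ * Φ ℓ (zc10 μ R ℓ x) := by
  cases a <;> simp [Fpay, rho10, zflow_eq10]

lemma zc10_nonneg {N L : ℕ} (μ : ℝ) (hμ0 : 0 < μ)
    (R : Matrix (Fin N) (Fin L) ℝ) (hR : ∀ i ℓ, R i ℓ = 0 ∨ R i ℓ = 1) (ℓ : Fin L)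
    (x : Fin N ⊕ Fin N → ℝ) (hx : ∀ a, 0 ≤ x a) : 0 ≤ zc10 μ R ℓ x := by
  rw [zc10_apply]
  refine Finset.sum_nonneg fun a _ => mul_nonneg (mul_nonneg ?_ ?_) (hx a)
  · cases a <;> simp [wt10, hμ0.le]
  · rcases hR (Sum.elim id id a) ℓ with h | h <;> simp [rho10, h]

lemma Jpay_eq10 {N L : ℕ} (μ : ℝ) (hμ0 : 0 < μ)
    (R : Matrix (Fin N) (Fin L) ℝ) (hR : ∀ i ℓ, R i ℓ = 0 ∨ R i ℓ = 1)
    (Φ : Fin L → ℝ → ℝ) (hΦ : ∀ ℓ, ContDiffOn ℝ 1 (Φ ℓ) (Set.Ici 0))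
    (x : Fin N ⊕ Fin N → ℝ) (hx : ∀ a, 0 ≤ x a) (a b : Fin N ⊕ Fin N) :
    Jpay μ R Φ x a b = -∑ ℓ, rho10 R a ℓ *
      (derivWithin (Φ ℓ) (Set.Ici 0) (zc10 μ R ℓ x) * (wt10 μ b * rho10 R b ℓ)) := by
  set S := {y : Fin N ⊕ Fin N → ℝ | ∀ c, 0 ≤ y c} with hS
  have hu : UniqueDiffWithinAt ℝ S x := by
    have h : S = Set.univ.pi (fun _ => Set.Ici (0:ℝ)) := by
      ext y; simp only [hS, Set.mem_setOf_eq, Set.mem_univ_pi, Set.mem_Ici]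
    rw [h]
    exact UniqueDiffOn.univ_pi (fun _ => uniqueDiffOn_Ici 0) x (fun a _ => hx a)
  have hd : HasFDerivWithinAt (Fpay μ R Φ) (ContinuousLinearMap.pi fun a =>
      -∑ ℓ, rho10 R a ℓ • (derivWithin (Φ ℓ) (Set.Ici 0) (zc10 μ R ℓ x) • zc10 μ R ℓ)) S x := by
    rw [hasFDerivWithinAt_pi]
    intro a
    simp only [Fpay_eq10]
    refine HasFDerivWithinAt.neg (HasFDerivWithinAt.fun_sum fun ℓ _ => ?_)
    refine HasFDerivWithinAt.const_mul ?_ _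
    have h1 : HasDerivWithinAt (Φ ℓ) (derivWithin (Φ ℓ) (Set.Ici 0) (zc10 μ R ℓ x))
        (Set.Ici 0) (zc10 μ R ℓ x) :=
      (((hΦ ℓ).differentiableOn (by norm_num)) _
        (zc10_nonneg μ hμ0 R hR ℓ x hx)).hasDerivWithinAt
    exact h1.comp_hasFDerivWithinAt x (zc10 μ R ℓ).hasFDerivWithinAt
      (fun y hy => zc10_nonneg μ hμ0 R hR ℓ y hy)
  have : Jpay μ R Φ x a b = fderivWithin ℝ (Fpay μ R Φ) S x (Pi.single b 1) a := rfl
  rw [this, hd.fderivWithin hu]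
  simp [zc10_apply, Pi.single_apply]

lemma mono10 {N L : ℕ} (μ : ℝ) (hμ0 : 0 < μ)
    (R : Matrix (Fin N) (Fin L) ℝ) (hR : ∀ i ℓ, R i ℓ = 0 ∨ R i ℓ = 1)
    (Φ : Fin L → ℝ → ℝ) (hΦ : ∀ ℓ, ContDiffOn ℝ 1 (Φ ℓ) (Set.Ici 0))
    (hΦ' : ∀ ℓ, ∀ s ∈ Set.Ici (0:ℝ), 0 ≤ derivWithin (Φ ℓ) (Set.Ici 0) s)
    (x y : Fin N ⊕ Fin N → ℝ) (hx : ∀ a, 0 ≤ x a) (hy : ∀ a, 0 ≤ y a) (ℓ : Fin L) :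
    0 ≤ (Φ ℓ (zc10 μ R ℓ x) - Φ ℓ (zc10 μ R ℓ y)) * (zc10 μ R ℓ x - zc10 μ R ℓ y) := by
  have hm : MonotoneOn (Φ ℓ) (Set.Ici 0) := by
    refine monotoneOn_of_deriv_nonneg (convex_Ici 0) (hΦ ℓ).continuousOn
      (((hΦ ℓ).differentiableOn (by norm_num)).mono interior_subset) fun s hs => ?_
    rw [← derivWithin_of_mem_nhds (mem_interior_iff_mem_nhds.1 hs)]
    exact hΦ' ℓ s (interior_subset hs)
  have h1 := zc10_nonneg μ hμ0 R hR ℓ x hx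
  have h2 := zc10_nonneg μ hμ0 R hR ℓ y hy
  rcases le_total (zc10 μ R ℓ x) (zc10 μ R ℓ y) with h | h
  · exact mul_nonneg_of_nonpos_of_nonpos (sub_nonpos.2 (hm h1 h2 h)) (sub_nonpos.2 h)
  · exact mul_nonneg (sub_nonneg.2 (hm h2 h1 h)) (sub_nonneg.2 h)

/-- (i) W·(∂F/∂x)(x) is symmetric and negative semidefinite on the orthant,
and (ii) F is weighted contractive with weight matrix W = diag(μI, I). -/
theorem stmt_10 {N L : ℕ} (μ : ℝ) (hμ0 : 0 < μ) (hμ1 : μ < 1)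
    (R : Matrix (Fin N) (Fin L) ℝ) (hR : ∀ i ℓ, R i ℓ = 0 ∨ R i ℓ = 1)
    (Φ : Fin L → ℝ → ℝ) (hΦ : ∀ ℓ, ContDiffOn ℝ 1 (Φ ℓ) (Set.Ici 0))
    (hΦ' : ∀ ℓ, ∀ s ∈ Set.Ici (0:ℝ), 0 ≤ derivWithin (Φ ℓ) (Set.Ici 0) s) :
    (∀ x : Fin N ⊕ Fin N → ℝ, (∀ a, 0 ≤ x a) →
        (Wmu N μ * Jpay μ R Φ x).IsSymm ∧
        ∀ ζ : Fin N ⊕ Fin N → ℝ, ζ ⬝ᵥ ((Wmu N μ * Jpay μ R Φ x) *ᵥ ζ) ≤ 0) ∧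
      (∀ x y : Fin N ⊕ Fin N → ℝ, (∀ a, 0 ≤ x a) → (∀ a, 0 ≤ y a) →
        (Wmu N μ *ᵥ Fpay μ R Φ x - Wmu N μ *ᵥ Fpay μ R Φ y) ⬝ᵥ (x - y) ≤ 0) := by
  have hW : Wmu N μ = Matrix.diagonal (wt10 μ) := rfl
  refine ⟨fun x hx => ⟨?_, fun ζ => ?_⟩, fun x y hx hy => ?_⟩
  · ext a b
    simp only [Matrix.transpose_apply, hW, Matrix.diagonal_mul,
      Jpay_eq10 μ hμ0 R hR Φ hΦ x hx, mul_neg, Finset.mul_sum]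
    congr 1
    refine Finset.sum_congr rfl fun ℓ _ => ?_
    ring
  · have key : ζ ⬝ᵥ ((Wmu N μ * Jpay μ R Φ x) *ᵥ ζ) =
        -∑ ℓ, derivWithin (Φ ℓ) (Set.Ici 0) (zc10 μ R ℓ x) * (zc10 μ R ℓ ζ * zc10 μ R ℓ ζ) := by
      simp only [dotProduct, Matrix.mulVec, hW, Matrix.diagonal_mul,
        Jpay_eq10 μ hμ0 R hR Φ hΦ x hx, zc10_apply _ _ _ ζ, Finset.mul_sum,
        Finset.sum_mul, mul_neg, neg_mul, Finset.sum_neg_distrib]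
      congr 1
      rw [Finset.sum_congr rfl fun a _ => Finset.sum_comm]
      rw [Finset.sum_comm]
      refine Finset.sum_congr rfl fun ℓ _ => Finset.sum_congr rfl fun a _ =>
        Finset.sum_congr rfl fun b _ => ?_
      ring
    rw [key, neg_nonpos]
    exact Finset.sum_nonneg fun ℓ _ => mul_nonneg
      (hΦ' ℓ _ (zc10_nonneg μ hμ0 R hR ℓ x hx)) (mul_self_nonneg _)
  · have key : (Wmu N μ *ᵥ Fpay μ R Φ x - Wmu N μ *ᵥ Fpay μ R Φ y) ⬝ᵥ (x - y) =
        -∑ ℓ, (Φ ℓ (zc10 μ R ℓ x) - Φ ℓ (zc10 μ R ℓ y)) * (zc10 μ R ℓ x - zc10 μ R ℓ y) := by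
      have h : ∀ ℓ, zc10 μ R ℓ x - zc10 μ R ℓ y = ∑ a, wt10 μ a * rho10 R a ℓ * (x a - y a) := by
        intro ℓ
        rw [← map_sub, zc10_apply]
        rfl
      simp only [h, Finset.mul_sum]
      rw [Finset.sum_comm, ← Finset.sum_neg_distrib]
      refine Finset.sum_congr rfl fun a _ => ?_
      simp only [Pi.sub_apply, hW, Matrix.mulVec_diagonal, Fpay_eq10]
      rw [← mul_sub, neg_sub_neg, ← Finset.sum_sub_distrib, Finset.mul_sum, Finset.sum_mul,
        ← Finset.sum_neg_distrib]
      refine Finset.sum_congr rfl fun ℓ _ => ?_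
      ring
    rw [key, neg_nonpos]
    exact Finset.sum_nonneg fun ℓ _ => mono10 μ hμ0 R hR Φ hΦ hΦ' x y hx hy ℓ
end

section
/- (Proposition 1(iii).) Let Π = Πᵀ ∈ ℝ^{2n×2n} have blocks Π₁₁ = 0, Π₁₂ = Π₂₁ᵀ, Π₂₂, and let P ∈ ℝ^{n×n} be the orthogonal projection onto TX. Suppose A₁,…,A_k ∈ ℝ^{n×n} satisfy P[Aᵢ; I]ᵀ Π [Aᵢ; I]P ⪯ 0 for each i, and B₁,…,B_s ∈ ℝ^{n×n} satisfy P(Π₁₂ᵀBⱼ + BⱼᵀΠ₁₂)P ⪯ 0 for each j. Then for every matrix M = A + B with A ∈ conv{A₁,…,A_k} and B ∈ cone{B₁,…,B_s}, and every ζ ∈ TX, ζᵀ(MᵀΠ₁₂ + Π₁₂ᵀM + Π₂₂)ζ ≤ 0. -/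
open Matrix Finset

/-- Proposition 1(iii): with Π₁₁ = 0 and P the orthogonal projection onto
TX, if P[Aᵢ; I]ᵀΠ[Aᵢ; I]P ⪯ 0 for each i and P(Π₁₂ᵀBⱼ + BⱼᵀΠ₁₂)P ⪯ 0 for each j, then
every M = A + B with A ∈ conv{A₁,…,A_k}, B ∈ cone{B₁,…,B_s} satisfies
ζᵀ(MᵀΠ₁₂ + Π₁₂ᵀM + Π₂₂)ζ ≤ 0 for all ζ ∈ TX. -/
theorem stmt_13 {ρ : ℕ} (hρ : 0 < ρ) (nn : Fin ρ → ℕ) (hnn : ∀ r, 0 < nn r)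
    (P12 P22 : Matrix ((r : Fin ρ) × Fin (nn r)) ((r : Fin ρ) × Fin (nn r)) ℝ)
    (hP22 : P22.IsSymm)
    (P : Matrix ((r : Fin ρ) × Fin (nn r)) ((r : Fin ρ) × Fin (nn r)) ℝ)
    (hPsymm : P.IsSymm)
    (hPrange : ∀ v, P *ᵥ v ∈ popTX nn)
    (hPfix : ∀ v ∈ popTX nn, P *ᵥ v = v)
    (k s : ℕ)
    (A : Fin k → Matrix ((r : Fin ρ) × Fin (nn r)) ((r : Fin ρ) × Fin (nn r)) ℝ)
    (B : Fin s → Matrix ((r : Fin ρ) × Fin (nn r)) ((r : Fin ρ) × Fin (nn r)) ℝ)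
    (hA : ∀ i, ∀ v : ((r : Fin ρ) × Fin (nn r)) → ℝ,
      v ⬝ᵥ ((P * ((A i)ᵀ * P12 + P12ᵀ * A i + P22) * P) *ᵥ v) ≤ 0)
    (hB : ∀ j, ∀ v : ((r : Fin ρ) × Fin (nn r)) → ℝ,
      v ⬝ᵥ ((P * (P12ᵀ * B j + (B j)ᵀ * P12) * P) *ᵥ v) ≤ 0) :
    ∀ lam : Fin k → ℝ, (∀ i, 0 ≤ lam i) → ∑ i, lam i = 1 →
      ∀ θ : Fin s → ℝ, (∀ j, 0 ≤ θ j) →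
        ∀ ζ ∈ popTX nn,
          ζ ⬝ᵥ ((((∑ i, lam i • A i) + ∑ j, θ j • B j)ᵀ * P12 +
              P12ᵀ * ((∑ i, lam i • A i) + ∑ j, θ j • B j) + P22) *ᵥ ζ) ≤ 0 := by
  intro lam hlam hsum θ hθ ζ hζ
  have key : ∀ M : Matrix ((r : Fin ρ) × Fin (nn r)) ((r : Fin ρ) × Fin (nn r)) ℝ,
      ζ ⬝ᵥ ((P * M * P) *ᵥ ζ) = ζ ⬝ᵥ (M *ᵥ ζ) := by
    intro M
    rw [← Matrix.mulVec_mulVec, hPfix ζ hζ, ← Matrix.mulVec_mulVec, Matrix.dotProduct_mulVec,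
      ← Matrix.mulVec_transpose, hPsymm.eq, hPfix ζ hζ]
  have hM : (((∑ i, lam i • A i) + ∑ j, θ j • B j)ᵀ * P12 +
              P12ᵀ * ((∑ i, lam i • A i) + ∑ j, θ j • B j) + P22)
      = ∑ i, lam i • ((A i)ᵀ * P12 + P12ᵀ * A i + P22)
        + ∑ j, θ j • (P12ᵀ * B j + (B j)ᵀ * P12) := by
    have h22 : ∑ i, lam i • P22 = P22 := by rw [← Finset.sum_smul, hsum, one_smul]
    simp only [smul_add, Finset.sum_add_distrib, h22, Matrix.transpose_add, Matrix.transpose_sum,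
      Matrix.transpose_smul, Matrix.add_mul, Matrix.mul_add, Matrix.sum_mul, Matrix.mul_sum,
      Matrix.smul_mul, Matrix.mul_smul]
    abel
  rw [hM, Matrix.add_mulVec, dotProduct_add, Matrix.sum_mulVec, Matrix.sum_mulVec,
    dotProduct_sum, dotProduct_sum]
  refine add_nonpos (Finset.sum_nonpos fun i _ => ?_) (Finset.sum_nonpos fun j _ => ?_)
  · rw [Matrix.smul_mulVec, dotProduct_smul, smul_eq_mul, ← key]
    exact mul_nonpos_of_nonneg_of_nonpos (hlam i) (hA i ζ)
  · rw [Matrix.smul_mulVec, dotProduct_smul, smul_eq_mul, ← key]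
    exact mul_nonpos_of_nonneg_of_nonpos (hθ j) (hB j ζ)
end

section
/- In the mixed-autonomy congestion game, define for each link ℓ the matrix Bℓ = −[Rℓ; Rℓ]·[μRℓᵀ, Rℓᵀ] ∈ ℝ^{2N×2N}, where Rℓ is the ℓ-th column of R. Then: (i) for every x ∈ ℝ^{2N}_{≥0}, the Jacobian satisfies ∂F/∂x(x) = Σℓ Φ'ℓ(zℓ(x)) Bℓ, hence ∂F/∂x(x) lies in the conic hull cone{B₁,…,B_L}; and (ii) for each ℓ, with W = diag(μI_N, I_N) and wℓ = (μRℓ, Rℓ) ∈ ℝ^{2N}, one has W Bℓ + Bℓᵀ W = −2 wℓ wℓᵀ, which is negative semidefinite. -/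
open Matrix Finset

/-- The row vector wℓ = (μRℓ, Rℓ) ∈ ℝ^{2N}. -/
noncomputable def wvec {N L : ℕ} (μ : ℝ) (R : Matrix (Fin N) (Fin L) ℝ) (ℓ : Fin L) :
    Fin N ⊕ Fin N → ℝ :=
  Sum.elim (fun i => μ * R i ℓ) (fun i => R i ℓ)

/-- The matrix Bℓ = −[Rℓ; Rℓ]·[μRℓᵀ, Rℓᵀ]. -/
noncomputable def Bmat {N L : ℕ} (μ : ℝ) (R : Matrix (Fin N) (Fin L) ℝ) (ℓ : Fin L) :
    Matrix (Fin N ⊕ Fin N) (Fin N ⊕ Fin N) ℝ :=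
  -Matrix.vecMulVec (fun a => R (Sum.elim id id a) ℓ) (wvec μ R ℓ)

/-- The link flow as a continuous linear map. -/
noncomputable def zlin {N L : ℕ} (μ : ℝ) (R : Matrix (Fin N) (Fin L) ℝ) (ℓ : Fin L) :
    (Fin N ⊕ Fin N → ℝ) →L[ℝ] ℝ :=
  ∑ i, R i ℓ • (μ • ContinuousLinearMap.proj (R := ℝ) (φ := fun _ : Fin N ⊕ Fin N => ℝ) (Sum.inl i)
    + ContinuousLinearMap.proj (R := ℝ) (φ := fun _ : Fin N ⊕ Fin N => ℝ) (Sum.inr i))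

theorem zlin_apply {N L : ℕ} (μ : ℝ) (R : Matrix (Fin N) (Fin L) ℝ) (ℓ : Fin L)
    (x : Fin N ⊕ Fin N → ℝ) : zlin μ R ℓ x = zflow μ R x ℓ := by
  simp [zlin, zflow, mul_add]

theorem zlin_single {N L : ℕ} (μ : ℝ) (R : Matrix (Fin N) (Fin L) ℝ) (ℓ : Fin L)
    (b : Fin N ⊕ Fin N) : zlin μ R ℓ (Pi.single b 1) = wvec μ R ℓ b := by
  rw [zlin_apply]
  rcases b with j | j
  · simp [zflow, wvec, Pi.single_apply, mul_comm]
  · simp [zflow, wvec, Pi.single_apply]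

theorem Jpay_eq {N L : ℕ} (μ : ℝ) (hμ0 : 0 < μ)
    (R : Matrix (Fin N) (Fin L) ℝ) (hR : ∀ i ℓ, 0 ≤ R i ℓ)
    (Φ : Fin L → ℝ → ℝ) (hΦ : ∀ ℓ, ContDiffOn ℝ 1 (Φ ℓ) (Set.Ici 0))
    (x : Fin N ⊕ Fin N → ℝ) (hx : ∀ a, 0 ≤ x a) :
    Jpay μ R Φ x =
      ∑ ℓ, derivWithin (Φ ℓ) (Set.Ici 0) (zflow μ R x ℓ) • Bmat μ R ℓ := by
  have hz : ∀ y : Fin N ⊕ Fin N → ℝ, (∀ a, 0 ≤ y a) → ∀ ℓ, zflow μ R y ℓ ∈ Set.Ici (0:ℝ) := by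
    intro y hy ℓ
    refine Finset.sum_nonneg fun i _ => mul_nonneg (hR i ℓ) ?_
    exact add_nonneg (mul_nonneg hμ0.le (hy _)) (hy _)
  have hU : UniqueDiffWithinAt ℝ {y : Fin N ⊕ Fin N → ℝ | ∀ c, 0 ≤ y c} x := by
    have h : UniqueDiffOn ℝ (Set.pi Set.univ (fun _ : Fin N ⊕ Fin N => Set.Ici (0:ℝ))) :=
      UniqueDiffOn.univ_pi (fun _ => uniqueDiffOn_Ici 0)
    have he : {y : Fin N ⊕ Fin N → ℝ | ∀ c, 0 ≤ y c}
        = Set.pi Set.univ (fun _ : Fin N ⊕ Fin N => Set.Ici (0:ℝ)) := by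
      ext y
      exact ⟨fun h c _ => h c, fun h c => h c trivial⟩
    rw [he]
    exact h x (fun c _ => hx c)
  have hc : ∀ ℓ, HasFDerivWithinAt (fun y => Φ ℓ (zflow μ R y ℓ))
      (derivWithin (Φ ℓ) (Set.Ici 0) (zflow μ R x ℓ) • zlin μ R ℓ)
      {y : Fin N ⊕ Fin N → ℝ | ∀ c, 0 ≤ y c} x := by
    intro ℓ
    have h1 : HasDerivWithinAt (Φ ℓ) (derivWithin (Φ ℓ) (Set.Ici 0) (zflow μ R x ℓ))
        (Set.Ici 0) (zflow μ R x ℓ) :=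
      (((hΦ ℓ).differentiableOn one_ne_zero) _ (hz x hx ℓ)).hasDerivWithinAt
    have h2 : HasFDerivWithinAt (fun y => zflow μ R y ℓ) (zlin μ R ℓ)
        {y : Fin N ⊕ Fin N → ℝ | ∀ c, 0 ≤ y c} x := by
      have := (zlin μ R ℓ).hasFDerivWithinAt
        (s := {y : Fin N ⊕ Fin N → ℝ | ∀ c, 0 ≤ y c}) (x := x)
      refine this.congr (fun y _ => (zlin_apply μ R ℓ y).symm) (zlin_apply μ R ℓ x).symm
    exact h1.comp_hasFDerivWithinAt x h2 (fun y hy => hz y hy ℓ)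
  have hF : HasFDerivWithinAt (Fpay μ R Φ)
      (ContinuousLinearMap.pi fun a : Fin N ⊕ Fin N => -∑ ℓ, R (Sum.elim id id a) ℓ •
        (derivWithin (Φ ℓ) (Set.Ici 0) (zflow μ R x ℓ) • zlin μ R ℓ))
      {y : Fin N ⊕ Fin N → ℝ | ∀ c, 0 ≤ y c} x := by
    rw [hasFDerivWithinAt_pi']
    intro a
    have h3 : HasFDerivWithinAt
        (fun y => -∑ ℓ, R (Sum.elim id id a) ℓ * Φ ℓ (zflow μ R y ℓ))
        (-∑ ℓ, R (Sum.elim id id a) ℓ •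
          (derivWithin (Φ ℓ) (Set.Ici 0) (zflow μ R x ℓ) • zlin μ R ℓ))
        {y : Fin N ⊕ Fin N → ℝ | ∀ c, 0 ≤ y c} x :=
      (HasFDerivWithinAt.fun_sum fun ℓ _ => (hc ℓ).const_mul (R (Sum.elim id id a) ℓ)).neg
    rcases a with i | i
    · exact h3
    · exact h3
  ext a b
  simp only [Jpay, Matrix.of_apply, hF.fderivWithin hU]
  simp [zlin_single, Matrix.sum_apply, Bmat,
    Matrix.vecMulVec_apply]
  refine Finset.sum_congr rfl fun ℓ _ => by ring

/-- (i) ∂F/∂x(x) = Σℓ Φ'ℓ(zℓ(x))Bℓ, so it lies in cone{B₁,…,B_L}; and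
(ii) W Bℓ + Bℓᵀ W = −2 wℓ wℓᵀ, which is negative semidefinite. -/
theorem stmt_14 {N L : ℕ} (μ : ℝ) (hμ0 : 0 < μ) (hμ1 : μ < 1)
    (R : Matrix (Fin N) (Fin L) ℝ) (hR : ∀ i ℓ, R i ℓ = 0 ∨ R i ℓ = 1)
    (Φ : Fin L → ℝ → ℝ) (hΦ : ∀ ℓ, ContDiffOn ℝ 1 (Φ ℓ) (Set.Ici 0))
    (hΦ' : ∀ ℓ, ∀ s ∈ Set.Ici (0:ℝ), 0 ≤ derivWithin (Φ ℓ) (Set.Ici 0) s) :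
    (∀ x : Fin N ⊕ Fin N → ℝ, (∀ a, 0 ≤ x a) →
        Jpay μ R Φ x =
          ∑ ℓ, derivWithin (Φ ℓ) (Set.Ici 0) (zflow μ R x ℓ) • Bmat μ R ℓ ∧
        ∃ θ : Fin L → ℝ, (∀ ℓ, 0 ≤ θ ℓ) ∧ Jpay μ R Φ x = ∑ ℓ, θ ℓ • Bmat μ R ℓ) ∧
      (∀ ℓ : Fin L,
        Wmu N μ * Bmat μ R ℓ + (Bmat μ R ℓ)ᵀ * Wmu N μ =
          (-2 : ℝ) • Matrix.vecMulVec (wvec μ R ℓ) (wvec μ R ℓ) ∧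
        ∀ ζ : Fin N ⊕ Fin N → ℝ,
          ζ ⬝ᵥ (((-2 : ℝ) • Matrix.vecMulVec (wvec μ R ℓ) (wvec μ R ℓ)) *ᵥ ζ) ≤ 0) := by
  have hR0 : ∀ i ℓ, 0 ≤ R i ℓ := by
    intro i ℓ
    rcases hR i ℓ with h | h <;> simp [h]
  refine ⟨fun x hx => ?_, fun ℓ => ⟨?_, fun ζ => ?_⟩⟩
  · have hJ := Jpay_eq μ hμ0 R hR0 Φ hΦ x hx
    refine ⟨hJ, _, fun ℓ => hΦ' ℓ _ ?_, hJ⟩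
    refine Finset.sum_nonneg fun i _ => mul_nonneg (hR0 i ℓ) ?_
    exact add_nonneg (mul_nonneg hμ0.le (hx _)) (hx _)
  · ext a b
    rcases a with i | i <;> rcases b with j | j <;>
      simp [Wmu, Bmat, wvec, Matrix.vecMulVec_apply, Matrix.diagonal_mul, Matrix.mul_diagonal] <;>
      ring
  · have h : ζ ⬝ᵥ (((-2 : ℝ) • Matrix.vecMulVec (wvec μ R ℓ) (wvec μ R ℓ)) *ᵥ ζ)
        = -2 * (wvec μ R ℓ ⬝ᵥ ζ) ^ 2 := by
      rw [Matrix.smul_mulVec, Matrix.vecMulVec_mulVec, dotProduct_smul]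
      simp [dotProduct_comm ζ]
      ring
    rw [h]
    nlinarith [sq_nonneg (wvec μ R ℓ ⬝ᵥ ζ)]
end

section
/- (Proposition 2.) Let Π = Πᵀ ∈ ℝ^{2n×2n} have blocks Π₁₁ = 0, Π₁₂ = Π₂₁ᵀ, Π₂₂, and let P ∈ ℝ^{n×n} be the orthogonal projection onto TX. Let G₀ ∈ ℝ^{n×n} and, for i = 1,…,d, let Cᵢ, Dᵢ ∈ ℝ^{n×ϱᵢ}. Set C = [C₁ ⋯ C_d], D = [D₁ ⋯ D_d] ∈ ℝ^{n×(ϱ₁+⋯+ϱ_d)}. Suppose there exist positive constants ω₁,…,ω_d such that, with Ω = diag(ω₁I_{ϱ₁},…,ω_dI_{ϱ_d}), the block matrix [[P(Π₁₂ᵀG₀ + G₀ᵀΠ₁₂ + Π₂₂)P, P(Π₁₂ᵀC + DΩ)], [(CᵀΠ₁₂ + ΩDᵀ)P, −2Ω]] is negative semidefinite. Then for every γ ∈ [0,1]^d, the matrix G = G₀ + γ₁C₁D₁ᵀ + ⋯ + γ_dC_dD_dᵀ satisfies ζᵀ(GᵀΠ₁₂ + Π₁₂ᵀG + Π₂₂)ζ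 ≤ 0 for all ζ ∈ TX. -/
open Matrix Finset

/-- Horizontal concatenation [M₁ ⋯ M_d] of matrices Mᵢ ∈ ℝ^{n×ϱᵢ}. -/
def hcat {ι : Type*} {d : ℕ} {ϱ : Fin d → ℕ}
    (M : (i : Fin d) → Matrix ι (Fin (ϱ i)) ℝ) :
    Matrix ι ((i : Fin d) × Fin (ϱ i)) ℝ :=
  Matrix.of fun a b => M b.1 a b.2

/-- Ω = diag(ω₁I_{ϱ₁},…,ω_dI_{ϱ_d}). -/
noncomputable def OmegaMat {d : ℕ} {ϱ : Fin d → ℕ} (ω : Fin d → ℝ) :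
    Matrix ((i : Fin d) × Fin (ϱ i)) ((i : Fin d) × Fin (ϱ i)) ℝ :=
  Matrix.diagonal fun b => ω b.1

/-- Proposition 2: if for some positive ω₁,…,ω_d the LMI
[[P(Π₁₂ᵀG₀+G₀ᵀΠ₁₂+Π₂₂)P, P(Π₁₂ᵀC+DΩ)], [(CᵀΠ₁₂+ΩDᵀ)P, −2Ω]] ⪯ 0 holds, then every
G = G₀ + Σᵢ γᵢCᵢDᵢᵀ with γ ∈ [0,1]^d satisfies ζᵀ(GᵀΠ₁₂+Π₁₂ᵀG+Π₂₂)ζ ≤ 0 on TX. -/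
theorem stmt_15 {ρ : ℕ} (hρ : 0 < ρ) (nn : Fin ρ → ℕ) (hnn : ∀ r, 0 < nn r)
    (P12 P22 : Matrix ((r : Fin ρ) × Fin (nn r)) ((r : Fin ρ) × Fin (nn r)) ℝ)
    (hP22 : P22.IsSymm)
    (P : Matrix ((r : Fin ρ) × Fin (nn r)) ((r : Fin ρ) × Fin (nn r)) ℝ)
    (hPsymm : P.IsSymm)
    (hPrange : ∀ v, P *ᵥ v ∈ popTX nn)
    (hPfix : ∀ v ∈ popTX nn, P *ᵥ v = v)
    (d : ℕ) (ϱ : Fin d → ℕ)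
    (G0 : Matrix ((r : Fin ρ) × Fin (nn r)) ((r : Fin ρ) × Fin (nn r)) ℝ)
    (C D : (i : Fin d) → Matrix ((r : Fin ρ) × Fin (nn r)) (Fin (ϱ i)) ℝ)
    (ω : Fin d → ℝ) (hω : ∀ i, 0 < ω i)
    (hLMI : ∀ v : (((r : Fin ρ) × Fin (nn r)) ⊕ ((i : Fin d) × Fin (ϱ i))) → ℝ,
      v ⬝ᵥ ((Matrix.fromBlocks
          (P * (P12ᵀ * G0 + G0ᵀ * P12 + P22) * P)
          (P * (P12ᵀ * hcat C + hcat D * OmegaMat ω))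
          (((hcat C)ᵀ * P12 + OmegaMat ω * (hcat D)ᵀ) * P)
          ((-2 : ℝ) • OmegaMat ω)) *ᵥ v) ≤ 0) :
    ∀ γ : Fin d → ℝ, (∀ i, γ i ∈ Set.Icc (0:ℝ) 1) →
      ∀ ζ ∈ popTX nn,
        ζ ⬝ᵥ (((G0 + ∑ i, γ i • (C i * (D i)ᵀ))ᵀ * P12 +
            P12ᵀ * (G0 + ∑ i, γ i • (C i * (D i)ᵀ)) + P22) *ᵥ ζ) ≤ 0 := by
  -- restate the LMI with `Ω` fully elaborated, so that every product is the product of `Matrix`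
  obtain ⟨Om, hOm⟩ : ∃ Om : Matrix ((i : Fin d) × Fin (ϱ i)) ((i : Fin d) × Fin (ϱ i)) ℝ,
      Om = OmegaMat (ϱ := ϱ) ω := ⟨_, rfl⟩
  have hLMI' : ∀ v : (((r : Fin ρ) × Fin (nn r)) ⊕ ((i : Fin d) × Fin (ϱ i))) → ℝ,
      v ⬝ᵥ ((Matrix.fromBlocks
          (P * (P12ᵀ * G0 + G0ᵀ * P12 + P22) * P)
          (P * (P12ᵀ * hcat C + hcat D * Om))
          (((hcat C)ᵀ * P12 + Om * (hcat D)ᵀ) * P)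
          ((-2 : ℝ) • Om)) *ᵥ v) ≤ 0 := by
    subst hOm
    exact hLMI
  intro γ hγ ζ hζ
  have hPz : P *ᵥ ζ = ζ := hPfix ζ hζ
  have hzP : ζ ᵥ* P = ζ := by
    rw [← hPsymm.eq, vecMul_transpose]; exact hPz
  set w := P12 *ᵥ ζ with hw
  set u : ((i : Fin d) × Fin (ϱ i)) → ℝ := (hcat D)ᵀ *ᵥ ζ with hu
  set y : ((i : Fin d) × Fin (ϱ i)) → ℝ := (hcat C)ᵀ *ᵥ w with hy
  have hT : ∀ A : Matrix ((r : Fin ρ) × Fin (nn r)) ((r : Fin ρ) × Fin (nn r)) ℝ,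
      ζ ⬝ᵥ ((Aᵀ * P12 + P12ᵀ * A + P22) *ᵥ ζ)
        = 2 * ((A *ᵥ ζ) ⬝ᵥ w) + ζ ⬝ᵥ (P22 *ᵥ ζ) := by
    intro A
    have h1 : ζ ⬝ᵥ (Aᵀ *ᵥ w) = (A *ᵥ ζ) ⬝ᵥ w := by
      rw [dotProduct_mulVec, vecMul_transpose]
    have h2 : ζ ⬝ᵥ (P12ᵀ *ᵥ (A *ᵥ ζ)) = (A *ᵥ ζ) ⬝ᵥ w := by
      rw [dotProduct_mulVec, vecMul_transpose, dotProduct_comm]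
    rw [add_mulVec, add_mulVec, dotProduct_add, dotProduct_add, ← mulVec_mulVec,
      ← mulVec_mulVec, ← hw, h1, h2]
    ring
  have hsum : ((∑ i, γ i • (C i * (D i)ᵀ)) *ᵥ ζ) ⬝ᵥ w = ∑ b, γ b.1 * u b * y b := by
    rw [sum_mulVec, sum_dotProduct, Fintype.sum_sigma]
    refine Finset.sum_congr rfl fun i _ => ?_
    have h1 : (C i *ᵥ ((D i)ᵀ *ᵥ ζ)) ⬝ᵥ w = ((D i)ᵀ *ᵥ ζ) ⬝ᵥ ((C i)ᵀ *ᵥ w) := by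
      rw [dotProduct_mulVec _ (C i)ᵀ, vecMul_transpose]
    rw [smul_mulVec, smul_dotProduct, ← mulVec_mulVec, h1, dotProduct, smul_eq_mul,
      Finset.mul_sum]
    refine Finset.sum_congr rfl fun j _ => ?_
    rw [← mul_assoc]
    rfl
  have key := hLMI' (Sum.elim ζ (fun b => γ b.1 * u b))
  set η : ((i : Fin d) × Fin (ϱ i)) → ℝ := fun b => γ b.1 * u b with hη
  rw [fromBlocks_mulVec, Sum.elim_comp_inl, Sum.elim_comp_inr,
    sumElim_dotProduct_sumElim, dotProduct_add, dotProduct_add] at key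
  have e1 : ζ ⬝ᵥ ((P * (P12ᵀ * G0 + G0ᵀ * P12 + P22) * P) *ᵥ ζ)
      = 2 * ((G0 *ᵥ ζ) ⬝ᵥ w) + ζ ⬝ᵥ (P22 *ᵥ ζ) := by
    rw [← hT, ← mulVec_mulVec, hPz, ← mulVec_mulVec, dotProduct_mulVec, hzP,
      add_comm (P12ᵀ * G0)]
  have e3 : η ⬝ᵥ ((((hcat C)ᵀ * P12 + Om * (hcat D)ᵀ) * P) *ᵥ ζ)
      = ∑ b, η b * (y b + ω b.1 * u b) := by
    rw [← mulVec_mulVec, hPz, add_mulVec, ← mulVec_mulVec, ← mulVec_mulVec, ← hw, ← hy, ← hu]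
    simp only [dotProduct, Pi.add_apply, hOm, OmegaMat, mulVec_diagonal]
  have e2 : ζ ⬝ᵥ ((P * (P12ᵀ * hcat C + hcat D * Om)) *ᵥ η)
      = ∑ b, η b * (y b + ω b.1 * u b) := by
    rw [← e3, dotProduct_mulVec η, dotProduct_comm _ ζ, ← mulVec_transpose]
    congr 2
    simp [transpose_mul, hPsymm.eq, hOm, OmegaMat]
  have e4 : η ⬝ᵥ (((-2 : ℝ) • Om) *ᵥ η) = ∑ b, -2 * (ω b.1 * η b ^ 2) := by
    rw [smul_mulVec]
    simp only [dotProduct, hOm, OmegaMat, Pi.smul_apply, mulVec_diagonal, smul_eq_mul]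
    refine Finset.sum_congr rfl fun b _ => ?_
    ring
  rw [e1, e2, e3, e4] at key
  rw [hT, add_mulVec, add_dotProduct, hsum]
  have hle : 2 * ∑ b, γ b.1 * u b * y b ≤ ∑ b, η b * (y b + ω b.1 * u b)
      + (∑ b, η b * (y b + ω b.1 * u b) + ∑ b, -2 * (ω b.1 * η b ^ 2)) := by
    rw [Finset.mul_sum, ← Finset.sum_add_distrib, ← Finset.sum_add_distrib]
    refine Finset.sum_le_sum fun b _ => ?_
    have h0 : 0 ≤ ω b.1 * u b ^ 2 * (γ b.1 * (1 - γ b.1)) :=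
      mul_nonneg (mul_nonneg (hω _).le (sq_nonneg _))
        (mul_nonneg (hγ _).1 (sub_nonneg.2 (hγ _).2))
    simp only [hη]
    nlinarith
  linarith
end
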